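/- arXiv:math/0601692 — 3 statements merged into one kernel-verified Lean document; each statement's English description precedes it below -/
import Mathlib

section
/- Let k be a number field and S a finite set of places of k containing the archimedean places such that the group of S-units O_{k,S}^* is finite. Let f and g be non-proportional irreducible homogeneous polynomials in x_0, …, x_n with coefficients in k, and let R be a subset of P^n(k) at whose points neither f nor g vanishes. Suppose there exist a, b ∈ k^* such that a·f(P)^{deg g}/g(P)^{deg f} ∈ O_{k,S} and b·g(P)^{deg f}/f(P)^{deg g} ∈ O_{k,S} for all P ∈ R. Then R is contained in a finite union of hypersurfaces of the form f^{deg g} = c·g^{deg f} with c ∈ k; in particular, R is not Zariski-dense. -/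
open scoped BigOperators
open NumberField IsDedekindDomain

/-- Bounded intervals of `ℤᵐ⁰` away from zero are finite. -/
theorem finite_Icc_withZero_multiplicative_int {c d : WithZero (Multiplicative ℤ)} (hc : c ≠ 0) :
    (Set.Icc c d).Finite := by
  obtain ⟨c, rfl⟩ := WithZero.ne_zero_iff_exists.1 hc
  rcases eq_or_ne d 0 with rfl | hd
  · rw [Set.Icc_eq_empty (by simp)]
    exact Set.finite_empty
  obtain ⟨d, rfl⟩ := WithZero.ne_zero_iff_exists.1 hd
  refine ((Set.finite_Icc c d).image
    fun x : Multiplicative ℤ => (x : WithZero (Multiplicative ℤ))).subset ?_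
  rintro x ⟨h₁, h₂⟩
  obtain ⟨x, rfl⟩ := WithZero.ne_zero_iff_exists.1 (fun h : x = 0 => by simp [h] at h₁)
  exact ⟨x, ⟨WithZero.coe_le_coe.1 h₁, WithZero.coe_le_coe.1 h₂⟩, rfl⟩

section Dedekind

variable {A K : Type*} [CommRing A] [IsDedekindDomain A] [Field K] [Algebra A K]
  [IsFractionRing A K]

/-- A nonzero element of the fraction field of a Dedekind domain has valuation one at all but
finitely many primes. -/
theorem finite_setOf_valuation_ne_one {x : K} (hx : x ≠ 0) :
    {v : HeightOneSpectrum A | v.valuation K x ≠ 1}.Finite := by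
  obtain ⟨r, s, hs, rfl⟩ := IsFractionRing.div_surjective (A := A) x
  have hs0 : s ≠ 0 := nonZeroDivisors.ne_zero hs
  have hr0 : r ≠ 0 := by rintro rfl; simp at hx
  have key : ∀ t : A, t ≠ 0 →
      {v : HeightOneSpectrum A | v.valuation K (algebraMap A K t) ≠ 1}.Finite := fun t ht =>
    (Ideal.finite_factors (I := Ideal.span {t}) (by simpa using ht)).subset fun v hv =>
      (v.valuation_lt_one_iff_dvd t).1 (lt_of_le_of_ne (v.valuation_le_one t) hv)
  refine ((key r hr0).union (key s hs0)).subset fun v hv => ?_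
  by_contra h
  simp only [Set.mem_union, Set.mem_ofPred_eq, not_or, not_not] at h
  exact hv (by simp [h.1, h.2])

/-- If there are finitely many `S`-units, a nonzero element has finitely many `S`-integral
divisors. -/
theorem finite_setOf_valuation_mem_Icc (S : Set (HeightOneSpectrum A)) [Finite (S.unit K)]
    {m : K} (hm : m ≠ 0) :
    {z : K | z ≠ 0 ∧ ∀ v ∉ S, v.valuation K m ≤ v.valuation K z ∧ v.valuation K z ≤ 1}.Finite := by
  set W := {v : HeightOneSpectrum A | v.valuation K m ≠ 1} ∩ Sᶜ
  have : Finite W := ((finite_setOf_valuation_ne_one hm).inter_of_left _).to_subtype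
  refine Set.Finite.of_finite_fibers (fun z (v : W) => v.1.valuation K z) ?_ ?_
  · refine (Set.Finite.pi' (t := fun v : W => Set.Icc (v.1.valuation K m) 1) fun v =>
      finite_Icc_withZero_multiplicative_int (by simpa using hm)).subset ?_
    rintro _ ⟨z, ⟨-, hz⟩, rfl⟩ v
    exact hz v.1 v.2.2
  · rintro _ ⟨y, ⟨hy0, hy⟩, rfl⟩
    refine (Set.finite_range fun u : S.unit K => (u : Kˣ) * y).subset ?_
    rintro z ⟨⟨hz0, hz⟩, hzy⟩
    refine ⟨⟨Units.mk0 (z / y) (div_ne_zero hz0 hy0), fun v hv => ?_⟩, ?_⟩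
    · have hyv : v.valuation K y ≠ 0 := by simpa using hy0
      have : v.valuation K z = v.valuation K y := by
        by_cases hmv : v.valuation K m = 1
        · exact ((hz v hv).2.antisymm (hmv ▸ (hz v hv).1)).trans
            ((hy v hv).2.antisymm (hmv ▸ (hy v hv).1)).symm
        · exact congrFun hzy ⟨v, hmv, hv⟩
      simp [this, div_self hyv]
    · simp [div_mul_cancel₀ _ hy0]

end Dedekind

/-- An irreducible homogeneous polynomial over a field has positive degree. -/
theorem MvPolynomial.IsHomogeneous.ne_zero_of_irreducible {σ k : Type*} [Field k] {d : ℕ}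
    {f : MvPolynomial σ k} (hf : f.IsHomogeneous d) (hirr : Irreducible f) : d ≠ 0 := by
  rintro rfl
  obtain ⟨c, rfl⟩ : ∃ c, f = C c :=
    ⟨_, totalDegree_eq_zero_iff_eq_C.1 (Nat.le_zero.1 hf.totalDegree_le)⟩
  exact hirr.not_isUnit ((IsUnit.mk0 c fun h => hirr.ne_zero (by simp [h])).map C)

/-- Powers of non-proportional irreducible polynomials are not proportional. -/
theorem MvPolynomial.pow_ne_C_mul_pow_of_irreducible {σ k : Type*} [Field k]
    {f g : MvPolynomial σ k} (hf : Irreducible f) (hg : Irreducible g)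
    (hprop : ∀ c : k, f ≠ c • g) {d : ℕ} (hd : d ≠ 0) (e : ℕ) (c : k) :
    f ^ d ≠ C c * g ^ e := by
  intro h
  have hc : c ≠ 0 := by
    rintro rfl
    exact pow_ne_zero d hf.ne_zero (by simpa using h)
  have hdvd : f ∣ C c * g ^ e := h ▸ dvd_pow_self f hd
  rcases hf.prime.dvd_or_dvd hdvd with h₁ | h₁
  · exact hf.not_isUnit (isUnit_of_dvd_unit h₁ ((IsUnit.mk0 c hc).map C))
  · obtain ⟨u, hu⟩ := (hf.associated_of_dvd hg (hf.prime.dvd_of_dvd_pow h₁)).symm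
    obtain ⟨r, -, hr⟩ := isUnit_iff_eq_C_of_isReduced.1 u.isUnit
    exact hprop r (by rw [← hu, hr, smul_eq_C_mul, mul_comm])

/-- Condition (b) of the main theorem: suppose the group of `S`-units of `k` is finite.
If `f` and `g` are non-proportional irreducible homogeneous polynomials and `R ⊆ ℙⁿ(k)`
is a set of points, off the hypersurfaces `f = 0` and `g = 0`, on which
`f^{deg g}/g^{deg f}` and its reciprocal are `S`-integral up to fixed constants, then
`R` is contained in a finite union of hypersurfaces `f^{deg g} = c·g^{deg f}`; in
particular `R` is not Zariski-dense. -/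
theorem not_zariski_dense_of_finite_S_units_two_components
    (k : Type*) [Field k] [NumberField k]
    (T : Finset (HeightOneSpectrum (𝓞 k)))
    (hfin : Finite ((↑T : Set (HeightOneSpectrum (𝓞 k))).unit k))
    (n df dg : ℕ) (f g : MvPolynomial (Fin (n + 1)) k)
    (hf : f.IsHomogeneous df) (hg : g.IsHomogeneous dg)
    (hfirr : Irreducible f) (hgirr : Irreducible g)
    (hprop : ∀ c : k, f ≠ c • g)
    (R : Set (Fin (n + 1) → k))
    (hR : ∀ x ∈ R, MvPolynomial.eval x f ≠ 0 ∧ MvPolynomial.eval x g ≠ 0)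
    (a b : k) (ha : a ≠ 0) (hb : b ≠ 0)
    (hab : ∀ x ∈ R, a * (MvPolynomial.eval x f) ^ dg / (MvPolynomial.eval x g) ^ df ∈
      (↑T : Set (HeightOneSpectrum (𝓞 k))).integer k)
    (hba : ∀ x ∈ R, b * (MvPolynomial.eval x g) ^ df / (MvPolynomial.eval x f) ^ dg ∈
      (↑T : Set (HeightOneSpectrum (𝓞 k))).integer k) :
    -- `R` is contained in a finite union of hypersurfaces `f^{deg g} = c·g^{deg f}`
    (∃ C : Finset k, ∀ x ∈ R, ∃ c ∈ C,
      (MvPolynomial.eval x f) ^ dg = c * (MvPolynomial.eval x g) ^ df) ∧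
    -- in particular, `R` is not Zariski-dense
    (∃ (d : ℕ) (P : MvPolynomial (Fin (n + 1)) k), P ≠ 0 ∧ P.IsHomogeneous d ∧
      ∀ x ∈ R, MvPolynomial.eval x P = 0) := by
  have hC : ∃ C : Finset k, ∀ x ∈ R, ∃ c ∈ C,
      (MvPolynomial.eval x f) ^ dg = c * (MvPolynomial.eval x g) ^ df := by
    have hZ := finite_setOf_valuation_mem_Icc (K := k)
      (↑T : Set (HeightOneSpectrum (𝓞 k))) (mul_ne_zero ha hb)
    classical
    refine ⟨hZ.toFinset.image (a⁻¹ * ·), fun x hx => ?_⟩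
    obtain ⟨hfx, hgx⟩ := hR x hx
    have hz : a * MvPolynomial.eval x f ^ dg / MvPolynomial.eval x g ^ df ≠ 0 := by positivity
    refine ⟨_, Finset.mem_image_of_mem _ (hZ.mem_toFinset.2 ⟨hz, fun v hv =>
      ⟨?_, hab x hx v hv⟩⟩), by field_simp⟩
    have hmul : a * b = a * MvPolynomial.eval x f ^ dg / MvPolynomial.eval x g ^ df *
        (b * MvPolynomial.eval x g ^ df / MvPolynomial.eval x f ^ dg) := by field_simp
    rw [hmul, map_mul]
    exact mul_le_of_le_one_right' (hba x hx v hv)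
  refine ⟨hC, ?_⟩
  obtain ⟨C, hC⟩ := hC
  refine ⟨_, ∏ c ∈ C, (f ^ dg - MvPolynomial.C c * g ^ df), ?_,
    MvPolynomial.IsHomogeneous.prod C _ (fun _ => df * dg) fun c _ =>
      (hf.pow dg).sub (mul_comm dg df ▸ (hg.pow df).C_mul c), fun x hx => ?_⟩
  · exact Finset.prod_ne_zero_iff.2 fun c _ => sub_ne_zero.2 <|
      MvPolynomial.pow_ne_C_mul_pow_of_irreducible hfirr hgirr hprop
        (hg.ne_zero_of_irreducible hgirr) df c
  · obtain ⟨c, hc, h⟩ := hC x hx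
    rw [map_prod]
    exact Finset.prod_eq_zero hc (by simp [h])
end

section
/- Let M be a finite extension of a number field k with [M:k] = n, and let σ_1, …, σ_n be the n embeddings of M into ℂ fixing k. Let a_1, …, a_n and b_1, …, b_n be nonidentical sequences of nonnegative integers with Σ_{i=1}^n a_i = Σ_{i=1}^n b_i. Then there exists x ∈ O_M, x ≠ 0, such that ∏_{i=1}^n σ_i(x)^{a_i} ≠ ∏_{i=1}^n σ_i(x)^{b_i}. -/
open scoped BigOperators
open NumberField

/-- A number field has an algebraic integer separating its embeddings over any subfield. -/
theorem exists_integer_algHom_apply_injective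
    (k M A : Type*) [Field k] [NumberField k] [Field M] [NumberField M] [Algebra k M]
    [Field A] [Algebra k A] :
    ∃ y : 𝓞 M, Function.Injective fun f : M →ₐ[k] A => f (y : M) := by
  have : FiniteDimensional k M := Module.Finite.right ℚ k M
  obtain ⟨θ, hθ⟩ := Field.exists_primitive_element k M
  have hθint : IsAlgebraic ℤ θ :=
    (IsFractionRing.isAlgebraic_iff ℤ ℚ M).mpr (Algebra.IsAlgebraic.isAlgebraic θ)
  obtain ⟨m, hm, hy⟩ := hθint.exists_integral_multiple
  refine ⟨⟨m • θ, hy⟩, fun f g hfg => ?_⟩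
  have hA : CharZero A := charZero_of_injective_algebraMap (algebraMap k A).injective
  have hmA : (m : A) ≠ 0 := Int.cast_ne_zero.mpr hm
  have hfθ : f θ = g θ := by
    have h : f (m • θ) = g (m • θ) := hfg
    rw [zsmul_eq_mul, map_mul, map_mul, map_intCast, map_intCast] at h
    exact mul_left_cancel₀ hmA h
  have htop : Algebra.adjoin k {θ} = ⊤ := by
    rw [← IntermediateField.adjoin_simple_toSubalgebra_of_isAlgebraic
      (Algebra.IsAlgebraic.isAlgebraic θ), hθ, IntermediateField.top_toSubalgebra]
  exact AlgHom.ext_of_adjoin_eq_top htop (by simpa [Set.EqOn] using hfθ)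

/-- The exponents in a product of powers of distinct monic linear factors are unique. -/
theorem prod_X_sub_C_pow_injective {ι R : Type*} [Fintype ι] [CommRing R] [IsDomain R]
    {r : ι → R} (hr : Function.Injective r) :
    Function.Injective fun a : ι → ℕ =>
      ∏ i, (Polynomial.X - Polynomial.C (r i)) ^ a i := by
  classical
  have key : ∀ (c : ι → ℕ) (j : ι),
      (∏ i, (Polynomial.X - Polynomial.C (r i)) ^ c i).roots.count (r j) = c j := by
    intro c j
    rw [Polynomial.roots_prod _ _ (Finset.prod_ne_zero_iff.mpr fun i _ =>
      pow_ne_zero _ (Polynomial.X_sub_C_ne_zero _)), Multiset.count_bind]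
    simp [Multiset.count_singleton, hr.eq_iff]
  intro a b hab
  funext j
  rw [← key a j, ← key b j]
  exact congrArg (fun p : Polynomial R => p.roots.count (r j)) hab

/-- Distinct exponent vectors yield genuinely distinct monomials in the conjugates:
if `σ₁, …, σₙ` enumerate the `n = [M:k]` embeddings of `M` into `ℂ` fixing `k` and
`a ≠ b` are sequences of nonnegative integers with `∑ aᵢ = ∑ bᵢ`, then there is a
nonzero algebraic integer `x ∈ 𝓞_M` with `∏ σᵢ(x)^{aᵢ} ≠ ∏ σᵢ(x)^{bᵢ}`. -/
theorem exists_integer_distinguishing_exponent_vectors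
    (k M : Type*) [Field k] [NumberField k] [Field M] [NumberField M] [Algebra k M]
    [Algebra k ℂ] (n : ℕ) (hn : Module.finrank k M = n)
    (σ : Fin n → (M →ₐ[k] ℂ)) (hσ : Function.Bijective σ)
    (a b : Fin n → ℕ) (hab : a ≠ b) (hsum : (∑ i, a i) = (∑ i, b i)) :
    ∃ x : 𝓞 M, x ≠ 0 ∧
      (∏ i, σ i ((x : 𝓞 M) : M) ^ a i) ≠ ∏ i, σ i ((x : 𝓞 M) : M) ^ b i := by
  obtain ⟨y, hy⟩ := exists_integer_algHom_apply_injective k M ℂ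
  by_contra! hall
  refine hab (prod_X_sub_C_pow_injective (hy.comp hσ.injective) ?_)
  have hfin : {t : ℤ | (t : 𝓞 M) = y}.Finite :=
    Set.Subsingleton.finite fun s hs t ht => Int.cast_injective (hs.trans ht.symm)
  have hinf : (((↑) : ℤ → ℂ) '' {t : ℤ | (t : 𝓞 M) = y}ᶜ).Infinite :=
    hfin.infinite_compl.image Int.cast_injective.injOn
  refine Polynomial.eq_of_infinite_eval_eq _ _ (hinf.mono ?_)
  rintro _ ⟨t, ht, rfl⟩
  have h := hall ((t : 𝓞 M) - y) (sub_ne_zero.mpr ht)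
  simpa [Polynomial.eval_prod] using h
end

section
/- Let k be a totally real number field and let F ⊆ ℂ be a finite Galois extension of k such that complex conjugation τ maps F onto F and maps φ(F) onto φ(F) for every field embedding φ : F → ℂ. Then the restriction τ|_F lies in G = Gal(F/k), and for every embedding φ : F → ℂ the composite τ∘φ⁻¹∘τ∘φ is a well-defined element of G. Let N be the subgroup of G generated by all elements τ∘φ⁻¹∘τ∘φ as φ ranges over the embeddings of F into ℂ, and let N' be the subgroup generated by N together with τ|_F. Let H be a subgroup of G such that τ|_F ∉ NH. Then the fixed field L = F^{NH} is a CM field and L' = F^{N'H} is its maximal real subfield; in particular L is totally imaginary, L' is totally real, and [L : L'] = 2. -/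
set_option synthInstance.maxHeartbeats 400000
set_option maxHeartbeats 2000000

open NumberField

/-- A number field is totally real if the image of every embedding into `ℂ` is fixed by
complex conjugation. -/
def IsTotallyRealField (L : Type*) [Field L] : Prop :=
  ∀ (φ : L →+* ℂ) (x : L), (starRingEnd ℂ) (φ x) = φ x

/-- A number field is totally imaginary if no embedding into `ℂ` has image contained
in `ℝ`. -/
def IsTotallyImaginaryField (L : Type*) [Field L] : Prop :=
  ∀ φ : L →+* ℂ, ∃ x : L, (starRingEnd ℂ) (φ x) ≠ φ x

open ComplexConjugate in
/-- An embedding of `F` whose image is stable under complex conjugation and whose restriction to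
`k` is real transports complex conjugation to a `k`-automorphism of `F`. -/
theorem exists_algEquiv_conj {k F : Type*} [Field k] [Field F] [Algebra k F]
    [FiniteDimensional k F] (φ : F →+* ℂ) (hφ : ∀ x, conj (φ x) ∈ Set.range φ)
    (hk : ∀ a : k, conj (φ (algebraMap k F a)) = φ (algebraMap k F a)) :
    ∃ σ : F ≃ₐ[k] F, ∀ x, φ (σ x) = conj (φ x) := by
  choose f hf using hφ
  let σ : F →ₐ[k] F :=
    { toFun := f
      map_one' := φ.injective (by simp [hf])
      map_mul' := fun x y => φ.injective (by simp [hf])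
      map_zero' := φ.injective (by simp [hf])
      map_add' := fun x y => φ.injective (by simp [hf])
      commutes' := fun a => φ.injective (by rw [hf, hk]) }
  exact ⟨AlgEquiv.ofBijective σ σ.bijective, hf⟩

/-- Adjoining to a subgroup an involution outside it that normalizes it doubles the order. -/
theorem Subgroup.card_sup_closure_singleton_of_involution {G : Type*} [Group G] {S : Subgroup G}
    {t : G} (ht : t * t = 1) (hS : ∀ s ∈ S, t * s * t ∈ S) (htS : t ∉ S) :
    Nat.card ↥(S ⊔ Subgroup.closure {t}) = 2 * Nat.card S := by
  have key : ∀ b ∈ S ⊔ Subgroup.closure {t}, b ∈ S ∨ b * t ∈ S := by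
    intro b hb
    rw [← Subgroup.closure_eq S, ← Subgroup.closure_union] at hb
    induction hb using Subgroup.closure_induction_right with
    | one => exact Or.inl S.one_mem
    | mul_right x _ y hy ih =>
      rcases hy with hy | rfl
      · refine ih.imp (fun h => S.mul_mem h hy) fun h => ?_
        have := S.mul_mem h (hS y hy)
        rwa [show x * t * (t * y * t) = x * (t * t) * y * t by group, ht, mul_one] at this
      · refine ih.symm.imp id fun h => ?_
        rwa [mul_assoc, ht, mul_one]
    | mul_inv_cancel x _ y hy ih =>
      rcases hy with hy | rfl
      · refine ih.imp (fun h => S.mul_mem h (S.inv_mem hy)) fun h => ?_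
        have := S.mul_mem h (hS _ (S.inv_mem hy))
        rwa [show x * t * (t * y⁻¹ * t) = x * (t * t) * y⁻¹ * t by group, ht, mul_one] at this
      · rw [inv_eq_of_mul_eq_one_left ht]
        refine ih.symm.imp id fun h => ?_
        rwa [mul_assoc, ht, mul_one]
  have hindex : S.relIndex (S ⊔ Subgroup.closure {t}) = 2 := by
    refine Subgroup.index_eq_two_iff.2
      ⟨⟨t, Subgroup.mem_sup_right (Subgroup.subset_closure rfl)⟩, fun b => ?_⟩
    simp only [Subgroup.mem_subgroupOf, Subgroup.coe_mul]
    rcases key b b.2 with h | h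
    · exact Or.inr ⟨h, fun h' => htS ((S.mul_mem_cancel_left h).1 h')⟩
    · exact Or.inl ⟨h, fun h' => htS ((S.mul_mem_cancel_left h').1 h)⟩
  rw [← Subgroup.relIndex_bot_left, ← Subgroup.relIndex_bot_left,
    ← Subgroup.relIndex_mul_relIndex ⊥ S _ bot_le le_sup_left, hindex, mul_comm]

/-- Lemma 3.9 of the paper: let `k ⊆ F ⊆ ℂ` with `k` totally real and `F/k` finite
Galois, and suppose complex conjugation `τ` maps `F` onto `F` and `φ(F)` onto `φ(F)`
for every embedding `φ : F → ℂ`.  Then `τ|_F ∈ G = Gal(F/k)`, each composite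
`τ∘φ⁻¹∘τ∘φ` is a well-defined element of `G` (characterized by
`φ(τ|_F(g x)) = τ(φ x)`), and for any subgroup `H ≤ G` with `τ|_F ∉ NH` (where `N` is
generated by the `τ∘φ⁻¹∘τ∘φ` and `N' = ⟨N, τ|_F⟩`), the fixed field `L = F^{NH}` is a
CM field with maximal real subfield `L' = F^{N'H}`: `L` is totally imaginary, `L'` is
totally real, `[L : L'] = 2`, and every totally real subfield of `L` lies in `L'`. -/
theorem fixedField_is_CM_of_conjugation_subgroups
    (F : Subfield ℂ) [NumberField F] (k : Subfield F) [NumberField k]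
    (hk : IsTotallyRealField k) [FiniteDimensional k F] [IsGalois k F]
    (hF : ∀ x : ℂ, x ∈ F → (starRingEnd ℂ) x ∈ F)
    (hphi : ∀ (φ : F →+* ℂ) (x : F), (starRingEnd ℂ) (φ x) ∈ Set.range φ) :
    ∃ τF : F ≃ₐ[k] F,
      -- `τF` is the restriction of complex conjugation to `F`, an element of `Gal(F/k)`
      (∀ x : F, ((τF x : F) : ℂ) = (starRingEnd ℂ) (x : ℂ)) ∧
      -- each composite `τ∘φ⁻¹∘τ∘φ` is a well-defined element of `Gal(F/k)`
      (∀ φ : F →+* ℂ, ∃ g : F ≃ₐ[k] F,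
        ∀ x : F, φ (τF (g x)) = (starRingEnd ℂ) (φ x)) ∧
      ∀ N N' : Subgroup (F ≃ₐ[k] F),
        N = Subgroup.closure {g : F ≃ₐ[k] F |
          ∃ φ : F →+* ℂ, ∀ x : F, φ (τF (g x)) = (starRingEnd ℂ) (φ x)} →
        N' = N ⊔ Subgroup.closure {τF} →
        ∀ H : Subgroup (F ≃ₐ[k] F), τF ∉ N ⊔ H →
          ∀ L L' : IntermediateField k F,
            L = IntermediateField.fixedField (N ⊔ H) →
            L' = IntermediateField.fixedField (N' ⊔ H) →
            L' ≤ L ∧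
            IsTotallyImaginaryField L ∧
            IsTotallyRealField L' ∧
            Module.finrank k L = 2 * Module.finrank k L' ∧
            ∀ K : IntermediateField k F, K ≤ L → IsTotallyRealField K → K ≤ L' := by
  have hkφ (φ : F →+* ℂ) (a : k) :
      (starRingEnd ℂ) (φ (algebraMap k F a)) = φ (algebraMap k F a) :=
    hk (φ.comp (algebraMap k F)) a
  have hσ (φ : F →+* ℂ) := exists_algEquiv_conj (k := k) φ (hphi φ) (hkφ φ)
  obtain ⟨τ, hτ⟩ := hσ F.subtype
  have hττ : τ * τ = 1 := by
    ext x
    change F.subtype (τ (τ x)) = F.subtype x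
    rw [hτ, hτ, Complex.conj_conj]
  have hττ' (x : F) : τ (τ x) = x := DFunLike.congr_fun hττ x
  have hg (φ : F →+* ℂ) : ∃ g : F ≃ₐ[k] F, ∀ x : F, φ (τ (g x)) = (starRingEnd ℂ) (φ x) := by
    obtain ⟨σ, h⟩ := hσ φ
    exact ⟨τ * σ, fun x => by rw [AlgEquiv.mul_apply, hττ', h]⟩
  refine ⟨τ, hτ, hg, ?_⟩
  rintro N N' hN rfl H hτH L L' rfl rfl
  have hgN (φ : F →+* ℂ) : ∃ g ∈ N, ∀ x : F, φ (τ (g x)) = (starRingEnd ℂ) (φ x) := by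
    obtain ⟨g, h⟩ := hg φ
    exact ⟨g, hN ▸ Subgroup.subset_closure ⟨φ, h⟩, h⟩
  have hcomm (s : F ≃ₐ[k] F) : s⁻¹ * τ * s * τ ∈ N := by
    rw [← N.inv_mem_iff, hN]
    refine Subgroup.subset_closure ⟨F.subtype.comp (s : F →+* F), fun x => ?_⟩
    have h : s * τ * (s⁻¹ * τ * s * τ)⁻¹ = τ * s := by
      have : τ⁻¹ = τ := inv_eq_of_mul_eq_one_left hττ
      simp only [mul_inv_rev, this, inv_inv, mul_assoc]
      rw [← mul_assoc τ τ, hττ, one_mul, mul_inv_cancel_left]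
    exact (congrArg F.subtype (DFunLike.congr_fun h x)).trans (hτ (s x))
  have hnorm : ∀ s ∈ N ⊔ H, τ * s * τ ∈ N ⊔ H := fun s hs => by
    have := (N ⊔ H).mul_mem hs (Subgroup.mem_sup_left (hcomm s))
    rwa [← mul_assoc, ← mul_assoc, ← mul_assoc, mul_inv_cancel, one_mul] at this
  rw [sup_right_comm]
  have hcard := Subgroup.card_sup_closure_singleton_of_involution hττ hnorm hτH
  have hle := IntermediateField.fixedField_antitone (F := k) (E := F)
    (le_sup_left : N ⊔ H ≤ N ⊔ H ⊔ Subgroup.closure {τ})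
  refine ⟨hle, fun φ => ?_, fun φ x => ?_, ?_, fun K hKL hK => ?_⟩
  · by_contra! hφ
    obtain ⟨g, hgN, h⟩ := hgN (ComplexEmbedding.lift F φ)
    refine hτH (((N ⊔ H).mul_mem_cancel_right (Subgroup.mem_sup_left hgN)).1 ?_)
    rw [← IntermediateField.fixingSubgroup_fixedField (N ⊔ H),
      IntermediateField.mem_fixingSubgroup_iff]
    intro x hx
    refine (ComplexEmbedding.lift F φ).injective ((h x).trans ?_)
    have hx' := ComplexEmbedding.lift_algebraMap_apply F φ ⟨x, hx⟩
    rw [IntermediateField.algebraMap_apply] at hx'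
    rw [hx', hφ]
  · obtain ⟨g, hgN, h⟩ := hgN (ComplexEmbedding.lift F φ)
    have hx := ComplexEmbedding.lift_algebraMap_apply F φ x
    rw [IntermediateField.algebraMap_apply] at hx
    have hfix := (IntermediateField.mem_fixedField_iff _ _).1 x.2
    rw [← hx, ← h, hfix g (Subgroup.mem_sup_left (Subgroup.mem_sup_left hgN)),
      hfix τ (Subgroup.mem_sup_right (Subgroup.subset_closure rfl))]
  · have h₁ := Module.finrank_mul_finrank k (IntermediateField.fixedField (N ⊔ H)) F
    have h₂ := Module.finrank_mul_finrank k
      (IntermediateField.fixedField (N ⊔ H ⊔ Subgroup.closure {τ})) F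
    rw [IntermediateField.finrank_fixedField_eq_card] at h₁ h₂
    rw [hcard, ← h₁] at h₂
    refine Nat.eq_of_mul_eq_mul_right (Nat.card_pos (α := ↥(N ⊔ H))) ?_
    rw [← h₂]
    ring
  · rw [IntermediateField.le_iff_le] at hKL ⊢
    refine sup_le hKL ((Subgroup.closure_le _).2 (Set.singleton_subset_iff.2 ?_))
    refine (IntermediateField.mem_fixingSubgroup_iff _ _).2 fun x hx => Subtype.ext ?_
    exact (hτ x).trans (hK (F.subtype.comp (algebraMap K F)) ⟨x, hx⟩)
end
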